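/- (Catalan gold.) Let α = (√5 − 1)/2 and let n ≥ 1 be an integer, with convergent p_n/q_n = Fib(n−1)/Fib(n) of α. Then √5 · (α − Fib(n−1)/Fib(n)) = Σ_{k=0}^{∞} (−1)^{(n+1)(k+1)} · C_k / (5^k · Fib(n)^{2k+2}), where C_k = (2k)!/(k!·(k+1)!) is the k-th Catalan number; the series converges absolutely. -/

import Mathlib

theorem succ_succ_mul_catalan_succ (k : ℕ) :
    (k + 2) * catalan (k + 1) = 2 * (2 * k + 1) * catalan k := by
  have h := Nat.succ_mul_centralBinom_succ k
  rw [← succ_mul_catalan_eq_centralBinom, ← succ_mul_catalan_eq_centralBinom] at h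
  refine Nat.eq_of_mul_eq_mul_left (Nat.succ_pos k) ?_
  rw [Nat.succ_eq_add_one]
  linarith

theorem catalan_succ_le_four_pow (k : ℕ) : catalan (k + 1) ≤ 4 ^ k := by
  induction k with
  | zero => simp
  | succ k ih =>
    have h := succ_succ_mul_catalan_succ (k + 1)
    rw [pow_succ]
    refine le_of_mul_le_mul_left (a := k + 1 + 2) ?_ (by omega)
    nlinarith

section CatalanSeries

variable {x : ℝ}

theorem abs_catalan_succ_mul_pow_le (hx : |x| ≤ 1 / 5) (k : ℕ) :
    |(catalan (k + 1) : ℝ) * x ^ (k + 1)| ≤ 1 / 5 * (4 / 5) ^ k := by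
  have hc : (catalan (k + 1) : ℝ) ≤ 4 ^ k := by exact_mod_cast catalan_succ_le_four_pow k
  rw [abs_mul, abs_pow, Nat.abs_cast]
  calc (catalan (k + 1) : ℝ) * |x| ^ (k + 1) ≤ 4 ^ k * (1 / 5) ^ (k + 1) := by gcongr
    _ = 1 / 5 * (4 / 5) ^ k := by rw [div_pow, div_pow]; field_simp; ring

theorem hasSum_one_fifth_mul_geometric :
    HasSum (fun k : ℕ => (1 / 5 : ℝ) * (4 / 5) ^ k) 1 := by
  have h := (hasSum_geometric_of_lt_one (r := (4 / 5 : ℝ)) (by norm_num)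
    (by norm_num)).mul_left (1 / 5)
  norm_num at h ⊢
  exact h

theorem summable_abs_catalan_mul_pow (hx : |x| ≤ 1 / 5) :
    Summable fun k : ℕ => |(catalan k : ℝ) * x ^ k| := by
  rw [← summable_nat_add_iff 1]
  exact hasSum_one_fifth_mul_geometric.summable.of_nonneg_of_le (fun _ => abs_nonneg _)
    (abs_catalan_succ_mul_pow_le hx)

theorem abs_tsum_catalan_mul_pow_le (hx : |x| ≤ 1 / 5) :
    |∑' k : ℕ, (catalan k : ℝ) * x ^ k| ≤ 2 := by
  have htail : |∑' k : ℕ, (catalan (k + 1) : ℝ) * x ^ (k + 1)| ≤ 1 := by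
    rw [← Real.norm_eq_abs]
    exact tsum_of_norm_bounded hasSum_one_fifth_mul_geometric (abs_catalan_succ_mul_pow_le hx)
  rw [(summable_abs_catalan_mul_pow hx).of_abs.tsum_eq_zero_add]
  simp only [catalan_zero, Nat.cast_one, pow_zero, mul_one]
  rw [abs_le] at htail ⊢
  constructor <;> linarith

theorem tsum_catalan_mul_pow_eq (hx : |x| ≤ 1 / 5) :
    ∑' k : ℕ, (catalan k : ℝ) * x ^ k = 1 + x * (∑' k : ℕ, (catalan k : ℝ) * x ^ k) ^ 2 := by
  have hs : Summable fun k : ℕ => ‖(catalan k : ℝ) * x ^ k‖ := summable_abs_catalan_mul_pow hx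
  rw [sq, tsum_mul_tsum_eq_tsum_sum_antidiagonal_of_summable_norm hs hs, ← tsum_mul_left,
    hs.of_norm.tsum_eq_zero_add]
  congr 1
  · rw [catalan_zero, Nat.cast_one, pow_zero, mul_one]
  · refine tsum_congr fun k => ?_
    rw [catalan_succ', Nat.cast_sum, Finset.sum_mul, Finset.mul_sum]
    refine Finset.sum_congr rfl fun p hp => ?_
    rw [← Finset.HasAntidiagonal.mem_antidiagonal.mp hp]
    push_cast
    ring

/-- The Catalan generating function is the only solution of `y = 1 + x y²` of size at most `2`. -/
theorem tsum_catalan_mul_pow_unique (hx : |x| ≤ 1 / 5) {y : ℝ} (hy : |y| ≤ 2)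
    (h : y = 1 + x * y ^ 2) : ∑' k : ℕ, (catalan k : ℝ) * x ^ k = y := by
  have hS := abs_tsum_catalan_mul_pow_le hx
  have hSeq := tsum_catalan_mul_pow_eq hx
  set S := ∑' k : ℕ, (catalan k : ℝ) * x ^ k
  have hlt : x * (S + y) < 1 := by
    have hsum : |S + y| ≤ 4 := (abs_add_le S y).trans (by linarith)
    calc x * (S + y) ≤ |x| * |S + y| := by rw [← abs_mul]; exact le_abs_self _
      _ ≤ 1 / 5 * 4 := by gcongr
      _ < 1 := by norm_num
  have hprod : (S - y) * (1 - x * (S + y)) = 0 := by linear_combination hSeq - h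
  rcases mul_eq_zero.mp hprod with h0 | h0 <;> linarith

end CatalanSeries


/-- The golden ratio `(√5 - 1)/2`. -/
noncomputable def alpha : ℝ := (Real.sqrt 5 - 1) / 2

/-- Catalan gold: for every `n ≥ 1`, with the convergent `Fib(n-1)/Fib(n)` of the
golden ratio `α`, we have
`√5 · (α - Fib(n-1)/Fib(n)) = Σ_{k=0}^∞ (-1)^{(n+1)(k+1)} C_k / (5^k Fib(n)^{2k+2})`,
where `C_k` is the `k`-th Catalan number; the series converges absolutely. -/
theorem catalan_gold (n : ℕ) (hn : 1 ≤ n) :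
    Summable (fun k : ℕ =>
        |(-1 : ℝ) ^ ((n + 1) * (k + 1)) * (catalan k : ℝ) /
          (5 ^ k * (Nat.fib n : ℝ) ^ (2 * k + 2))|) ∧
    Real.sqrt 5 * (alpha - (Nat.fib (n - 1) : ℝ) / (Nat.fib n : ℝ)) =
      ∑' k : ℕ, (-1 : ℝ) ^ ((n + 1) * (k + 1)) * (catalan k : ℝ) /
          (5 ^ k * (Nat.fib n : ℝ) ^ (2 * k + 2)) := by
  have hF : (1 : ℝ) ≤ (Nat.fib n : ℝ) := by exact_mod_cast Nat.fib_pos.mpr hn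
  set F : ℝ := (Nat.fib n : ℝ) with hFdef
  have hF0 : F ≠ 0 := by linarith
  have h5 : Real.sqrt 5 * Real.sqrt 5 = 5 := Real.mul_self_sqrt (by norm_num)
  set s : ℝ := (-1) ^ n with hs
  have hss : s * s = 1 := by rw [hs, ← mul_pow]; norm_num
  have hsabs : |s| = 1 := by rw [hs, abs_pow]; norm_num
  set u : ℝ := Real.goldenConj ^ n with hu
  have huv : Real.goldenRatio ^ n * u = s := by
    rw [hu, ← mul_pow, Real.goldenRatio_mul_goldenConj]
  have hbinet : Real.sqrt 5 * F = Real.goldenRatio ^ n - u := by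
    rw [hFdef, Real.coe_fib_eq, mul_div_cancel₀ _ (by positivity)]
  have hconv : alpha * F - Nat.fib (n - 1) = -u := by
    obtain ⟨m, rfl⟩ : ∃ m, n = m + 1 := ⟨n - 1, by omega⟩
    rw [hu, ← Real.goldenConj_mul_fib_succ_add_fib, alpha, Real.goldenConj, Nat.add_sub_cancel]
    ring
  have huabs : |u| ≤ 1 := by
    rw [hu, abs_pow]
    refine pow_le_one₀ (abs_nonneg _) (abs_le.mpr ⟨Real.neg_one_lt_goldenConj.le, ?_⟩)
    linarith [Real.goldenConj_neg]
  have hx : |-s / (5 * F ^ 2)| ≤ 1 / 5 := by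
    rw [abs_div, abs_neg, hsabs, abs_of_pos (by positivity)]
    gcongr
    nlinarith
  have hterm (k : ℕ) : (-1 : ℝ) ^ ((n + 1) * (k + 1)) * (catalan k : ℝ) /
      (5 ^ k * F ^ (2 * k + 2)) =
        -s / F ^ 2 * ((catalan k : ℝ) * (-s / (5 * F ^ 2)) ^ k) := by
    rw [pow_mul, pow_succ (-1 : ℝ) n, ← hs, mul_neg_one, div_pow, mul_pow, ← pow_mul]
    field_simp
    ring
  have hy : s * (Real.sqrt 5 * F) * u = 1 - s * u ^ 2 := by
    rw [hbinet]; linear_combination s * huv + hss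
  have hsum := tsum_catalan_mul_pow_unique hx (y := s * (Real.sqrt 5 * F) * u)
    (by
      rw [hy]
      have hsu : |s * u ^ 2| ≤ 1 := by
        rw [abs_mul, hsabs, one_mul, abs_pow]
        exact pow_le_one₀ (abs_nonneg _) huabs
      rw [abs_le] at hsu ⊢
      constructor <;> linarith)
    (by
      have hsq : -s / (5 * F ^ 2) * (s * (Real.sqrt 5 * F) * u) ^ 2 = -(s * u ^ 2) := by
        field_simp
        linear_combination (-s ^ 3 * u ^ 2) * h5 - 5 * s * u ^ 2 * hss
      rw [hsq, hy]
      ring)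
  simp only [hterm]
  refine ⟨?_, ?_⟩
  · simp only [abs_mul (-s / F ^ 2)]
    exact (summable_abs_catalan_mul_pow hx).mul_left _
  · rw [tsum_mul_left, hsum]
    field_simp
    linear_combination hconv + u * hss
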